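/- Let (X_n)_{n∈ℤ} be a strictly stationary reversible real-valued Markov chain, g square-integrable with ∫ g dπ = 0, and Y_i = g(X_i). Then for all integers j, k with 1 ≤ k ≤ j, E( E_{k-1}(Y_k) · E_{j-1}(Y_j) ) = E( Y_0 Y_{j-k+2} ). -/

import Mathlib

open MeasureTheory ProbabilityTheory Filter

noncomputable section

/-- The sigma-algebra generated by the past of the process up to time `k`. -/
def pastSigma {Ω : Type*} [MeasurableSpace Ω] (X : ℤ → Ω → ℝ) (k : ℤ) : MeasurableSpace Ω :=
  ⨆ j : ℤ, ⨆ _ : j ≤ k, MeasurableSpace.comap (X j) inferInstance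

/-- A strictly stationary, reversible, real-valued Markov chain indexed by `ℤ`. -/
structure IsStationaryReversibleMarkov {Ω : Type*} [MeasurableSpace Ω]
    (μ : Measure Ω) (X : ℤ → Ω → ℝ) : Prop where
  meas : ∀ n, Measurable (X n)
  stationary : ∀ n : ℤ,
    μ.map (fun ω => fun k : ℤ => X (k + n) ω) = μ.map (fun ω => fun k : ℤ => X k ω)
  reversible : μ.map (fun ω => (X 0 ω, X 1 ω)) = μ.map (fun ω => (X 1 ω, X 0 ω))
  markov : ∀ (n : ℤ) (g : ℝ → ℝ), Measurable g → (∀ x, |g x| ≤ 1) →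
    (μ[(fun ω => g (X (n + 1) ω)) | pastSigma X n]
      =ᵐ[μ] μ[(fun ω => g (X (n + 1) ω)) | MeasurableSpace.comap (X n) inferInstance])

lemma pastSigma_le {Ω : Type*} [mΩ : MeasurableSpace Ω] {X : ℤ → Ω → ℝ}
    (hX : ∀ n, Measurable (X n)) (k : ℤ) : pastSigma X k ≤ mΩ :=
  iSup₂_le fun j _ => (hX j).comap_le

lemma measurable_pastSigma {Ω : Type*} [MeasurableSpace Ω] {X : ℤ → Ω → ℝ} {i k : ℤ}
    (hik : i ≤ k) : Measurable[pastSigma X k] (X i) :=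
  Measurable.of_comap_le
    (le_iSup₂ (f := fun (j : ℤ) (_ : j ≤ k) => MeasurableSpace.comap (X j) inferInstance) i hik)

/-- If conditioning bounded functions of `Z` on two sigma-algebras gives the same result, so does
conditioning integrable functions of `Z`. -/
lemma condExp_comp_ae_eq_of_forall_bounded {Ω : Type*} {m₁ m₂ mΩ : MeasurableSpace Ω}
    {μ : Measure Ω} [IsFiniteMeasure μ] (hm₁ : m₁ ≤ mΩ) (hm₂ : m₂ ≤ mΩ) {Z : Ω → ℝ}
    (hZ : Measurable Z)
    (h : ∀ g : ℝ → ℝ, Measurable g → (∀ x, |g x| ≤ 1) →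
      μ[(fun ω => g (Z ω)) | m₁] =ᵐ[μ] μ[(fun ω => g (Z ω)) | m₂])
    {f : ℝ → ℝ} (hf : Measurable f) (hfi : Integrable (fun ω => f (Z ω)) μ) :
    μ[(fun ω => f (Z ω)) | m₁] =ᵐ[μ] μ[(fun ω => f (Z ω)) | m₂] := by
  let t : ℕ → ℝ → ℝ := fun n x => if |f x| ≤ n then f x else 0
  have ht_meas (n : ℕ) : Measurable (t n) :=
    Measurable.ite (measurableSet_le hf.abs measurable_const) hf measurable_const
  have ht_le (n : ℕ) (x : ℝ) : ‖t n x‖ ≤ ‖f x‖ := by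
    by_cases hx : |f x| ≤ n <;> simp [t, hx]
  have ht_tendsto (x : ℝ) : Tendsto (fun n => t n x) atTop (nhds (f x)) := by
    refine tendsto_const_nhds.congr' ?_
    obtain ⟨N, hN⟩ := exists_nat_ge |f x|
    filter_upwards [eventually_ge_atTop N] with n hn
    have : |f x| ≤ n := hN.trans (by exact_mod_cast hn)
    simp [t, this]
  have ht_eq (n : ℕ) :
      μ[(fun ω => t n (Z ω)) | m₁] =ᵐ[μ] μ[(fun ω => t n (Z ω)) | m₂] := by
    have hc : (0 : ℝ) < n + 1 := by positivity
    have hscale : (fun ω => t n (Z ω)) = ((n : ℝ) + 1) • fun ω => t n (Z ω) / (n + 1) := by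
      ext ω
      simp only [Pi.smul_apply, smul_eq_mul]
      field_simp
    have hbound (x : ℝ) : |t n x / (n + 1)| ≤ 1 := by
      rw [abs_div, abs_of_pos hc, div_le_one hc]
      by_cases hx : |f x| ≤ n
      · simp only [t, hx, if_true]
        linarith
      · simp only [t, hx, if_false, abs_zero]
        exact hc.le
    rw [hscale]
    filter_upwards [condExp_smul (μ := μ) ((n : ℝ) + 1) (fun ω => t n (Z ω) / (n + 1)) m₁,
      condExp_smul (μ := μ) ((n : ℝ) + 1) (fun ω => t n (Z ω) / (n + 1)) m₂,
      h (fun x => t n x / (n + 1)) ((ht_meas n).div_const _) hbound] with ω h₁ h₂ h₃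
    rw [h₁, h₂, Pi.smul_apply, Pi.smul_apply, h₃]
  have hlim {m : MeasurableSpace Ω} (hm : m ≤ mΩ) :
      Tendsto (fun n => condExpL1 hm μ (fun ω => t n (Z ω))) atTop
        (nhds (condExpL1 hm μ (fun ω => f (Z ω)))) :=
    tendsto_condExpL1_of_dominated_convergence hm (fun ω => ‖f (Z ω)‖)
      (fun n => ((ht_meas n).comp hZ).aestronglyMeasurable) hfi.norm
      (fun n => ae_of_all _ fun ω => ht_le n (Z ω)) (ae_of_all _ fun ω => ht_tendsto (Z ω))
  have hL1 (n : ℕ) : condExpL1 hm₁ μ (fun ω => t n (Z ω)) =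
      condExpL1 hm₂ μ (fun ω => t n (Z ω)) := by
    ext1
    exact (condExp_ae_eq_condExpL1 hm₁ _).symm.trans
      ((ht_eq n).trans (condExp_ae_eq_condExpL1 hm₂ _))
  have heq := tendsto_nhds_unique_of_eventuallyEq (hlim hm₁) (hlim hm₂) (Eventually.of_forall hL1)
  exact (condExp_ae_eq_condExpL1 hm₁ _).trans
    (heq ▸ (condExp_ae_eq_condExpL1 hm₂ _).symm)

/-- The transition operator of the chain: `f` is sent to a version of `x ↦ E(f(X_1) | X_0 = x)`. -/
def transition {Ω : Type*} [MeasurableSpace Ω] (μ : Measure Ω) [IsFiniteMeasure μ]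
    (X : ℤ → Ω → ℝ) (f : ℝ → ℝ) : ℝ → ℝ :=
  fun x => ∫ y, f y ∂condDistrib (X 1) (X 0) μ x

lemma measurable_transition {Ω : Type*} [MeasurableSpace Ω] {μ : Measure Ω} [IsFiniteMeasure μ]
    {X : ℤ → Ω → ℝ} {f : ℝ → ℝ} (hf : Measurable f) : Measurable (transition μ X f) :=
  (hf.stronglyMeasurable.integral_kernel).measurable

namespace IsStationaryReversibleMarkov

variable {Ω : Type*} [MeasurableSpace Ω] {μ : Measure Ω} {X : ℤ → Ω → ℝ}

lemma map_pair_shift (hX : IsStationaryReversibleMarkov μ X) (i j n : ℤ) :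
    μ.map (fun ω => (X (i + n) ω, X (j + n) ω)) = μ.map (fun ω => (X i ω, X j ω)) := by
  have hmeas (n : ℤ) : Measurable fun ω => fun k : ℤ => X (k + n) ω :=
    measurable_pi_lambda _ fun k => hX.meas (k + n)
  have hmeas' : Measurable fun ω => fun k : ℤ => X k ω := measurable_pi_lambda _ hX.meas
  have hp : Measurable fun x : ℤ → ℝ => (x i, x j) :=
    (measurable_pi_apply i).prodMk (measurable_pi_apply j)
  have := congrArg (Measure.map fun x : ℤ → ℝ => (x i, x j)) (hX.stationary n)
  rwa [Measure.map_map hp (hmeas n), Measure.map_map hp hmeas'] at this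

lemma map_eq (hX : IsStationaryReversibleMarkov μ X) (n : ℤ) : μ.map (X n) = μ.map (X 0) := by
  have := congrArg (Measure.map Prod.fst) (hX.map_pair_shift 0 0 n)
  rw [Measure.map_map measurable_fst ((hX.meas _).prodMk (hX.meas _)),
    Measure.map_map measurable_fst ((hX.meas _).prodMk (hX.meas _))] at this
  simpa only [Function.comp_def, zero_add] using this

lemma memLp_comp (hX : IsStationaryReversibleMarkov μ X) {f : ℝ → ℝ}
    (hf : MemLp f 2 (μ.map (X 0))) (n : ℤ) : MemLp (fun ω => f (X n ω)) 2 μ := by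
  rw [← hX.map_eq n] at hf
  exact hf.comp_of_map (hX.meas n).aemeasurable

lemma integral_mul_shift (hX : IsStationaryReversibleMarkov μ X) {f q : ℝ → ℝ}
    (hf : Measurable f) (hq : Measurable q) (i j n : ℤ) :
    ∫ ω, f (X (i + n) ω) * q (X (j + n) ω) ∂μ = ∫ ω, f (X i ω) * q (X j ω) ∂μ := by
  have hF : Measurable fun p : ℝ × ℝ => f p.1 * q p.2 :=
    (hf.comp measurable_fst).mul (hq.comp measurable_snd)
  have h (i j : ℤ) := integral_map (μ := μ) ((hX.meas i).prodMk (hX.meas j)).aemeasurable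
    hF.aestronglyMeasurable
  rw [← h, ← h, hX.map_pair_shift]

lemma integral_mul_reverse (hX : IsStationaryReversibleMarkov μ X) {f q : ℝ → ℝ}
    (hf : Measurable f) (hq : Measurable q) :
    ∫ ω, f (X 0 ω) * q (X 1 ω) ∂μ = ∫ ω, f (X 1 ω) * q (X 0 ω) ∂μ := by
  have hF : Measurable fun p : ℝ × ℝ => f p.1 * q p.2 :=
    (hf.comp measurable_fst).mul (hq.comp measurable_snd)
  have h (i j : ℤ) := integral_map (μ := μ) ((hX.meas i).prodMk (hX.meas j)).aemeasurable
    hF.aestronglyMeasurable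
  rw [← h, ← h, hX.reversible]

variable [IsFiniteMeasure μ]

lemma condExp_comap_ae_eq_transition (hX : IsStationaryReversibleMarkov μ X) {f : ℝ → ℝ}
    (hf : Measurable f) (hf2 : MemLp f 2 (μ.map (X 0))) (n : ℤ) :
    μ[(fun ω => f (X (n + 1) ω)) | MeasurableSpace.comap (X n) inferInstance]
      =ᵐ[μ] fun ω => transition μ X f (X n ω) := by
  have hker : condDistrib (X (n + 1)) (X n) μ = condDistrib (X 1) (X 0) μ := by
    have := hX.map_pair_shift 0 1 n
    rw [zero_add, add_comm 1 n] at this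
    simp only [condDistrib, this]
  have := condExp_ae_eq_integral_condDistrib (hX.meas n) (hX.meas (n + 1)).aemeasurable
    hf.stronglyMeasurable ((hX.memLp_comp hf2 (n + 1)).integrable one_le_two)
  rwa [hker] at this

lemma condExp_past_ae_eq_transition (hX : IsStationaryReversibleMarkov μ X) {f : ℝ → ℝ}
    (hf : Measurable f) (hf2 : MemLp f 2 (μ.map (X 0))) (n : ℤ) :
    μ[(fun ω => f (X (n + 1) ω)) | pastSigma X n]
      =ᵐ[μ] fun ω => transition μ X f (X n ω) :=
  (condExp_comp_ae_eq_of_forall_bounded (pastSigma_le hX.meas n) (hX.meas n).comap_le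
    (hX.meas (n + 1)) (hX.markov n) hf
    ((hX.memLp_comp hf2 (n + 1)).integrable one_le_two)).trans
    (hX.condExp_comap_ae_eq_transition hf hf2 n)

lemma memLp_transition (hX : IsStationaryReversibleMarkov μ X) {f : ℝ → ℝ}
    (hf : Measurable f) (hf2 : MemLp f 2 (μ.map (X 0))) :
    MemLp (transition μ X f) 2 (μ.map (X 0)) := by
  rw [memLp_map_measure_iff (measurable_transition hf).aestronglyMeasurable
    (hX.meas 0).aemeasurable]
  exact ((hX.memLp_comp hf2 (0 + 1)).condExp one_le_two).ae_eq
    (hX.condExp_past_ae_eq_transition hf hf2 0)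

lemma integral_mul_eq_transition (hX : IsStationaryReversibleMarkov μ X) {f q : ℝ → ℝ}
    (hf : Measurable f) (hf2 : MemLp f 2 (μ.map (X 0)))
    (hq : Measurable q) (hq2 : MemLp q 2 (μ.map (X 0))) {i n : ℤ} (hin : i ≤ n) :
    ∫ ω, f (X i ω) * q (X (n + 1) ω) ∂μ = ∫ ω, f (X i ω) * transition μ X q (X n ω) ∂μ := by
  have hle := pastSigma_le hX.meas n
  have hfi := hX.memLp_comp hf2 i
  have hqn := hX.memLp_comp hq2 (n + 1)
  rw [← integral_condExp hle (f := fun ω => f (X i ω) * q (X (n + 1) ω))]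
  refine integral_congr_ae ?_
  have hpull := condExp_mul_of_stronglyMeasurable_left (μ := μ) (m := pastSigma X n)
    (f := fun ω => f (X i ω)) (g := fun ω => q (X (n + 1) ω))
    (hf.comp (measurable_pastSigma hin)).stronglyMeasurable
    (hfi.integrable_mul hqn) (hqn.integrable one_le_two)
  filter_upwards [hpull, hX.condExp_past_ae_eq_transition hq hq2 n] with ω h₁ h₂
  exact h₁.trans (congrArg (f (X i ω) * ·) h₂)

/-- The transition operator can be moved from one factor of a correlation to the other. -/
lemma integral_transition_mul (hX : IsStationaryReversibleMarkov μ X) {f : ℝ → ℝ}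
    (hf : Measurable f) (hf2 : MemLp f 2 (μ.map (X 0))) (n : ℕ) {q : ℝ → ℝ}
    (hq : Measurable q) (hq2 : MemLp q 2 (μ.map (X 0))) :
    ∫ ω, transition μ X f (X 0 ω) * q (X n ω) ∂μ
      = ∫ ω, f (X 0 ω) * transition μ X q (X n ω) ∂μ := by
  induction n generalizing q with
  | zero =>
    have h₁ := hX.integral_mul_eq_transition hq hq2 hf hf2 le_rfl (i := 0)
    have h₂ := hX.integral_mul_eq_transition hf hf2 hq hq2 le_rfl (i := 0)
    rw [zero_add] at h₁ h₂
    rw [Nat.cast_zero, ← h₂, hX.integral_mul_reverse hf hq]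
    simp only [mul_comm (transition μ X f _), mul_comm (f _), h₁]
  | succ n ih =>
    have hn : (0 : ℤ) ≤ n := Int.natCast_nonneg n
    rw [Nat.cast_succ, hX.integral_mul_eq_transition (measurable_transition hf)
      (hX.memLp_transition hf hf2) hq hq2 hn,
      hX.integral_mul_eq_transition hf hf2 (measurable_transition hq)
      (hX.memLp_transition hq hq2) hn]
    exact ih (measurable_transition hq) (hX.memLp_transition hq hq2)

end IsStationaryReversibleMarkov

/-- For `1 ≤ k ≤ j`: `E(E_{k-1}(Y_k) E_{j-1}(Y_j)) = E(Y_0 Y_{j-k+2})`. -/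
theorem condexp_proj_prod_eq {Ω : Type*} [MeasurableSpace Ω]
    (μ : Measure Ω) [IsProbabilityMeasure μ]
    (X : ℤ → Ω → ℝ) (hX : IsStationaryReversibleMarkov μ X)
    (g : ℝ → ℝ) (hg_meas : Measurable g)
    (hg_sq : Integrable (fun x => g x ^ 2) (μ.map (X 0)))
    (hg_mean : ∫ x, g x ∂(μ.map (X 0)) = 0)
    (k j : ℤ) (hk : 1 ≤ k) (hkj : k ≤ j) :
    ∫ ω, (μ[(fun ω' => g (X k ω')) | pastSigma X (k - 1)]) ω
        * (μ[(fun ω' => g (X j ω')) | pastSigma X (j - 1)]) ω ∂μ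
      = ∫ ω, g (X 0 ω) * g (X (j - k + 2) ω) ∂μ := by
  have hg2 : MemLp g 2 (μ.map (X 0)) :=
    (memLp_two_iff_integrable_sq hg_meas.aestronglyMeasurable).2 hg_sq
  have hPg := measurable_transition (μ := μ) (X := X) hg_meas
  have hk_cond := hX.condExp_past_ae_eq_transition hg_meas hg2 (k - 1)
  have hj_cond := hX.condExp_past_ae_eq_transition hg_meas hg2 (j - 1)
  rw [sub_add_cancel] at hk_cond hj_cond
  obtain ⟨n, hn⟩ := Int.eq_ofNat_of_zero_le (sub_nonneg.2 hkj)
  have hn0 : (0 : ℤ) ≤ n := Int.natCast_nonneg n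
  calc _ = ∫ ω, transition μ X g (X (k - 1) ω) * transition μ X g (X (j - 1) ω) ∂μ :=
        integral_congr_ae (hk_cond.mul hj_cond)
    _ = ∫ ω, transition μ X g (X 0 ω) * transition μ X g (X n ω) ∂μ := by
        rw [← hX.integral_mul_shift hPg hPg 0 n (k - 1), zero_add,
          show (n : ℤ) + (k - 1) = j - 1 by omega]
    _ = ∫ ω, transition μ X g (X 0 ω) * g (X ((n + 1 : ℕ) : ℤ) ω) ∂μ := by
        rw [Nat.cast_succ, hX.integral_mul_eq_transition hPg (hX.memLp_transition hg_meas hg2)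
          hg_meas hg2 hn0]
    _ = ∫ ω, g (X 0 ω) * transition μ X g (X ((n + 1 : ℕ) : ℤ) ω) ∂μ :=
        hX.integral_transition_mul hg_meas hg2 (n + 1) hg_meas hg2
    _ = ∫ ω, g (X 0 ω) * g (X (j - k + 2) ω) ∂μ := by
        rw [← hX.integral_mul_eq_transition hg_meas hg2 hg_meas hg2 (by positivity),
          show ((n + 1 : ℕ) : ℤ) + 1 = j - k + 2 by omega]
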